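/- arXiv:1707.09272 — 4 statements merged into one kernel-verified Lean document; each statement's English description precedes it below -/
import Mathlib

section
/- Let f₀ ∈ 𝓕, k a positive integer, μ ∈ ℝ and λ ∈ [−1,1]. Then the k-sine-skewed function f(θ) := f₀(θ−μ)·(1 + λ·sin(k(θ−μ))) is a probability density on the circle: f(θ) ≥ 0 for all θ ∈ ℝ, and ∫_{μ−π}^{μ+π} f(θ) dθ = 1. -/
open Real MeasureTheory

/-- The integral of an odd function over an interval symmetric about `0` vanishes. -/
theorem intervalIntegral_eq_zero_of_odd {g : ℝ → ℝ} (hg : ∀ x, g (-x) = -g x) (a : ℝ) :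
    ∫ x in (-a)..a, g x = 0 := by
  have h := intervalIntegral.integral_comp_neg (a := -a) (b := a) g
  simp only [hg, intervalIntegral.integral_neg, neg_neg] at h
  linarith

/-- For `f₀ ∈ 𝓕` (strictly positive, 2π-periodic, even, continuous,
integrating to 1 over `[-π, π]`), a positive integer `k`, `μ ∈ ℝ` and `λ ∈ [-1,1]`,
the k-sine-skewed function `θ ↦ f₀(θ-μ)·(1 + λ·sin(k(θ-μ)))` is nonnegative and
integrates to 1 over `[μ-π, μ+π]`. -/
theorem ksine_skewed_is_density
    (f₀ : ℝ → ℝ)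
    (hpos : ∀ θ, 0 < f₀ θ)
    (hper : ∀ θ, f₀ (θ + 2 * π) = f₀ θ)
    (heven : ∀ θ, f₀ (-θ) = f₀ θ)
    (hcont : Continuous f₀)
    (hint : ∫ θ in (-π)..π, f₀ θ = 1)
    (k : ℕ) (hk : 0 < k)
    (μ lam : ℝ) (hlam : lam ∈ Set.Icc (-1 : ℝ) 1) :
    (∀ θ : ℝ, 0 ≤ f₀ (θ - μ) * (1 + lam * Real.sin (k * (θ - μ)))) ∧
    ∫ θ in (μ - π)..(μ + π), f₀ (θ - μ) * (1 + lam * Real.sin (k * (θ - μ))) = 1 := by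
  refine ⟨fun θ => mul_nonneg (hpos _).le ?_, ?_⟩
  · have h : |lam * Real.sin (k * (θ - μ))| ≤ 1 := by
      rw [abs_mul]
      exact mul_le_one₀ (abs_le.mpr hlam) (abs_nonneg _) (Real.abs_sin_le_one _)
    linarith [(abs_le.mp h).1]
  · have hodd : ∫ θ in (-π)..π, f₀ θ * (lam * Real.sin (k * θ)) = 0 :=
      intervalIntegral_eq_zero_of_odd (fun θ => by simp [heven]) π
    rw [intervalIntegral.integral_comp_sub_right
      (fun θ => f₀ θ * (1 + lam * Real.sin (k * θ))) μ,
      sub_sub_cancel_left, add_sub_cancel_left]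
    simp only [mul_add, mul_one]
    rw [intervalIntegral.integral_add (hcont.intervalIntegrable _ _)
      (Continuous.intervalIntegrable (by fun_prop) _ _), hint, hodd, add_zero]
end

section
/- Let f₀ : ℝ → ℝ be continuously differentiable, 2π-periodic, even (f₀(−θ) = f₀(θ)), strictly positive, nonincreasing on [0, π] (unimodal with mode at 0), and not constant (f₀(0) > f₀(π)). Then the cross-information quantity Γ_{f₀,1;12} := −∫_{−π}^{π} sin(θ) f₀′(θ) dθ is strictly positive. In particular, the Fisher information matrix for the 1-sine-skewed family based on f₀ is never diagonal. -/
open Real MeasureTheory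

/-- For a continuously differentiable, 2π-periodic, even, strictly
positive density that is nonincreasing on `[0, π]` (unimodal with mode at `0`) and
not constant (`f₀(π) < f₀(0)`), the cross-information quantity
`Γ_{f₀,1;12} = -∫_{-π}^{π} sin θ · f₀'(θ) dθ` is strictly positive. -/
theorem cross_information_k1_positive
    (f₀ : ℝ → ℝ)
    (hcd : ContDiff ℝ 1 f₀)
    (hper : ∀ θ, f₀ (θ + 2 * π) = f₀ θ)
    (heven : ∀ θ, f₀ (-θ) = f₀ θ)
    (hpos : ∀ θ, 0 < f₀ θ)
    (hmono : AntitoneOn f₀ (Set.Icc 0 π))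
    (hnc : f₀ π < f₀ 0) :
    0 < -∫ θ in (-π)..π, Real.sin θ * deriv f₀ θ := by
  have hcont : Continuous fun θ => -(Real.sin θ * deriv f₀ θ) :=
    (Real.continuous_sin.mul (hcd.continuous_deriv le_rfl)).neg
  have hnonneg : ∀ θ ∈ Set.Icc 0 π, 0 ≤ -(Real.sin θ * deriv f₀ θ) := by
    rintro θ ⟨h0, hπ⟩
    rcases h0.eq_or_lt with rfl | h0
    · simp
    rcases hπ.eq_or_lt with rfl | hπ
    · simp
    have hderiv : deriv f₀ θ ≤ 0 := by
      rw [← derivWithin_of_mem_nhds (Icc_mem_nhds h0 hπ)]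
      exact hmono.derivWithin_nonpos
    have hsin := Real.sin_pos_of_pos_of_lt_pi h0 hπ
    exact neg_nonneg.mpr (mul_nonpos_of_nonneg_of_nonpos hsin.le hderiv)
  have hodd : ∀ θ, deriv f₀ (-θ) = -deriv f₀ θ := fun θ => by
    have h := deriv_comp_neg f₀ θ
    simp only [heven] at h
    linarith
  obtain ⟨c, ⟨hc0, hcπ⟩, hc⟩ := exists_deriv_eq_slope f₀ Real.pi_pos
    hcd.continuous.continuousOn (hcd.differentiable one_ne_zero).differentiableOn
  rw [← intervalIntegral.integral_neg]
  refine intervalIntegral.integral_pos (by linarith [Real.pi_pos]) hcont.continuousOn ?_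
    ⟨c, ⟨by linarith, hcπ.le⟩, ?_⟩
  · rintro θ ⟨hl, hr⟩
    rcases le_total 0 θ with h | h
    · exact hnonneg θ ⟨h, hr⟩
    · simpa [hodd] using hnonneg (-θ) ⟨by linarith, by linarith⟩
  · have hslope : deriv f₀ c < 0 := by
      rw [hc, sub_zero]
      exact div_neg_of_neg_of_pos (sub_neg.mpr hnc) Real.pi_pos
    exact neg_pos.mpr (mul_neg_of_pos_of_neg (Real.sin_pos_of_pos_of_lt_pi hc0 hcπ) hslope)
end

section
/- Let 0 ≤ ρ < 1 and let k be a positive integer. Then ∫_{−π}^{π} sin²(kθ)·(1−ρ²)/(1+ρ²−2ρ cos θ) dθ = π·(1−ρ^{2k}). Equivalently, the Fisher information quantity for skewness of the k-sine-skewed wrapped Cauchy family satisfies Γ_{WC,k;22} := ∫_{−π}^{π} sin²(kθ) f_{WC}(θ) dθ = (1−ρ²)·(Σ_{l=1}^{k} ρ^{2(l−1)})/2 = (1−ρ^{2k})/2. -/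
open Real MeasureTheory

/-- The Poisson kernel of the unit disc at a real point, in terms of the angle. -/
lemma poissonKernel_zero_ofReal_circleMap (ρ θ : ℝ) :
    poissonKernel 0 (ρ : ℂ) (circleMap 0 1 θ) =
      (1 - ρ ^ 2) / (1 + ρ ^ 2 - 2 * ρ * Real.cos θ) := by
  have hden : ‖circleMap 0 1 θ - (ρ : ℂ)‖ ^ 2 = 1 + ρ ^ 2 - 2 * ρ * Real.cos θ := by
    rw [← Complex.normSq_eq_norm_sq, Complex.normSq_apply]
    simp only [circleMap_zero, Complex.ofReal_one, one_mul, Complex.sub_re, Complex.sub_im,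
      Complex.exp_ofReal_mul_I_re, Complex.exp_ofReal_mul_I_im, Complex.ofReal_re,
      Complex.ofReal_im]
    linear_combination Real.sin_sq_add_cos_sq θ
  simp [poissonKernel_def, hden]

/-- On the unit circle `sin² (kθ)` is the real part of `(1 - z ^ (2 * k)) / 2`. -/
lemma re_one_sub_circleMap_pow_div_two (k : ℕ) (θ : ℝ) :
    ((1 - circleMap 0 1 θ ^ (2 * k)) / 2).re = Real.sin (k * θ) ^ 2 := by
  have hpow : circleMap 0 1 θ ^ (2 * k) = Complex.exp ((2 * (k * θ) : ℝ) * Complex.I) := by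
    rw [circleMap_zero, Complex.ofReal_one, one_mul, ← Complex.exp_nat_mul]
    push_cast
    ring_nf
  rw [hpow, Complex.div_ofNat_re, Complex.sub_re, Complex.one_re, Complex.exp_ofReal_mul_I_re,
    Real.cos_two_mul]
  linear_combination -Real.sin_sq_add_cos_sq (k * θ)

/-- The integral of `sin² (kθ)` against the Poisson kernel of the unit disc. -/
lemma integral_sin_sq_mul_poissonKernel {ρ : ℝ} (hρ : |ρ| < 1) (k : ℕ) :
    ∫ θ in (-π)..π,
        Real.sin (k * θ) ^ 2 * ((1 - ρ ^ 2) / (1 + ρ ^ 2 - 2 * ρ * Real.cos θ))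
      = π * (1 - ρ ^ (2 * k)) := by
  have hharm : InnerProductSpace.HarmonicOnNhd (fun z : ℂ ↦ ((1 - z ^ (2 * k)) / 2).re)
      (Metric.closedBall 0 1) := fun z _ ↦
    AnalyticAt.harmonicAt_re (f := fun z : ℂ ↦ (1 - z ^ (2 * k)) / 2) (by fun_prop)
  have hmem : (ρ : ℂ) ∈ Metric.ball (0 : ℂ) 1 := by simpa using hρ
  have hpoisson := hharm.circleAverage_poissonKernel_smul hmem
  have hval : ((1 - (ρ : ℂ) ^ (2 * k)) / 2).re = (1 - ρ ^ (2 * k)) / 2 := by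
    rw [Complex.div_ofNat_re, Complex.sub_re, Complex.one_re, ← Complex.ofReal_pow,
      Complex.ofReal_re]
  simp only [circleAverage_def, smul_eq_mul, Pi.mul_apply, poissonKernel_zero_ofReal_circleMap,
    re_one_sub_circleMap_pow_div_two, hval] at hpoisson
  have hperiodic : Function.Periodic (fun θ : ℝ ↦
      (1 - ρ ^ 2) / (1 + ρ ^ 2 - 2 * ρ * Real.cos θ) * Real.sin (k * θ) ^ 2) (2 * π) := by
    intro θ
    have hsin : Real.sin (k * (θ + 2 * π)) = Real.sin (k * θ) := by
      rw [mul_add, Real.sin_add_nat_mul_two_pi]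
    simp only [Real.cos_add_two_pi, hsin]
  have hshift := hperiodic.intervalIntegral_add_eq (-π) 0
  rw [zero_add, show -π + 2 * π = π by ring] at hshift
  simp_rw [mul_comm (Real.sin _ ^ 2)]
  rw [hshift]
  rw [inv_mul_eq_iff_eq_mul₀ Real.two_pi_pos.ne'] at hpoisson
  linarith

/-- For `0 ≤ ρ < 1` and a positive integer `k`,
`∫_{-π}^{π} sin²(kθ)·(1-ρ²)/(1+ρ²-2ρcos θ) dθ = π(1-ρ^{2k})`; equivalently the
Fisher information quantity for skewness of the k-sine-skewed wrapped Cauchy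
family satisfies
`Γ_{WC,k;22} = ∫_{-π}^{π} sin²(kθ) f_{WC}(θ) dθ = (1-ρ²)(Σ_{l=1}^{k} ρ^{2(l-1)})/2
 = (1-ρ^{2k})/2`. -/
theorem wrapped_cauchy_gamma22
    (ρ : ℝ) (h0 : 0 ≤ ρ) (h1 : ρ < 1) (k : ℕ) (hk : 0 < k) :
    (∫ θ in (-π)..π,
        (Real.sin (k * θ)) ^ 2 * ((1 - ρ ^ 2) / (1 + ρ ^ 2 - 2 * ρ * Real.cos θ))
      = π * (1 - ρ ^ (2 * k))) ∧
    (∫ θ in (-π)..π, (Real.sin (k * θ)) ^ 2 *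
        ((1 - ρ ^ 2) / (2 * π * (1 + ρ ^ 2 - 2 * ρ * Real.cos θ)))
      = (1 - ρ ^ 2) * (∑ l ∈ Finset.range k, ρ ^ (2 * l)) / 2) ∧
    ((1 - ρ ^ 2) * (∑ l ∈ Finset.range k, ρ ^ (2 * l)) / 2 = (1 - ρ ^ (2 * k)) / 2) := by
  have hint := integral_sin_sq_mul_poissonKernel (abs_lt.2 ⟨by linarith, h1⟩) k
  have hgeom : (1 - ρ ^ 2) * (∑ l ∈ Finset.range k, ρ ^ (2 * l)) / 2 = (1 - ρ ^ (2 * k)) / 2 := by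
    simp_rw [pow_mul, mul_neg_geom_sum]
  refine ⟨hint, ?_, hgeom⟩
  have hdensity (θ : ℝ) : Real.sin (k * θ) ^ 2 *
        ((1 - ρ ^ 2) / (2 * π * (1 + ρ ^ 2 - 2 * ρ * Real.cos θ))) =
      (2 * π)⁻¹ * (Real.sin (k * θ) ^ 2 *
        ((1 - ρ ^ 2) / (1 + ρ ^ 2 - 2 * ρ * Real.cos θ))) := by
    rw [div_mul_eq_div_div_swap, div_eq_inv_mul _ (2 * π)]
    ring
  simp_rw [hdensity]
  rw [intervalIntegral.integral_const_mul, hint, hgeom]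
  field_simp
end

section
/- Let 0 < ρ < 1/2. Then the Fisher information for location of the cardioid density f_C(θ) = (1 + 2ρ cos θ)/(2π), with score φ_C(θ) = 2ρ sin θ/(1 + 2ρ cos θ), satisfies Γ_{C;11} := ∫_{−π}^{π} φ_C(θ)² f_C(θ) dθ = (2ρ²/π)·∫_{−π}^{π} sin²θ/(1 + 2ρ cos θ) dθ = 1 − √(1 − 4ρ²); moreover the cross-information quantity Γ_{C,1;12} := ∫_{−π}^{π} sin θ·φ_C(θ)·f_C(θ) dθ equals ρ. -/
open Real MeasureTheory

lemma one_add_mul_cos_pos {a : ℝ} (ha : |a| < 1) (θ : ℝ) : 0 < 1 + a * cos θ := by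
  have h : |a * cos θ| < 1 := by
    rw [abs_mul]
    exact (mul_le_of_le_one_right (abs_nonneg a) (abs_cos_le_one θ)).trans_lt ha
  linarith [(abs_lt.mp h).1]

/-- The Poisson kernel integrates to `2π` over a period. -/
lemma integral_poisson_kernel {b : ℝ} (hb : |b| < 1) :
    ∫ θ in (-π)..π, (1 - b ^ 2) / (1 + 2 * b * cos θ + b ^ 2) = 2 * π := by
  have hpos := one_add_mul_cos_pos hb
  have hD (θ : ℝ) : 0 < 1 + 2 * b * cos θ + b ^ 2 := by
    nlinarith [pow_pos (hpos θ) 2, sq_nonneg (b * sin θ), sin_sq_add_cos_sq θ]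
  have hderiv (θ : ℝ) : HasDerivAt (fun t ↦ t - 2 * arctan (b * sin t / (1 + b * cos t)))
      ((1 - b ^ 2) / (1 + 2 * b * cos θ + b ^ 2)) θ := by
    have hq := ((hasDerivAt_sin θ).const_mul b).div
      (((hasDerivAt_cos θ).const_mul b).const_add 1) (hpos θ).ne'
    refine ((hasDerivAt_id θ).sub (hq.arctan.const_mul 2)).congr_deriv ?_
    have hne := (hpos θ).ne'
    have hsum : 1 + (b * sin θ / (1 + b * cos θ)) ^ 2
        = (1 + 2 * b * cos θ + b ^ 2) / (1 + b * cos θ) ^ 2 := by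
      field_simp
      linear_combination b ^ 2 * sin_sq_add_cos_sq θ
    have hDne := (hD θ).ne'
    simp only [Pi.div_apply]
    rw [hsum]
    field_simp
    linear_combination -2 * b ^ 2 * sin_sq_add_cos_sq θ
  rw [intervalIntegral.integral_eq_sub_of_hasDerivAt (fun θ _ ↦ hderiv θ)]
  · simp
    ring
  · exact (continuous_const.div (by fun_prop) fun θ ↦ (hD θ).ne').intervalIntegrable _ _

lemma integral_inv_one_add_mul_cos {a : ℝ} (ha : |a| < 1) :
    ∫ θ in (-π)..π, (1 + a * cos θ)⁻¹ = 2 * π / √(1 - a ^ 2) := by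
  have hlt : 0 < 1 - a ^ 2 := by linarith [(sq_lt_one_iff_abs_lt_one a).mpr ha]
  have hs : 0 < √(1 - a ^ 2) := sqrt_pos.mpr hlt
  have hsq : √(1 - a ^ 2) ^ 2 = 1 - a ^ 2 := sq_sqrt hlt.le
  generalize √(1 - a ^ 2) = s at hs hsq ⊢
  have hb : |a / (1 + s)| < 1 := by
    rw [abs_div, abs_of_pos (by linarith : 0 < 1 + s), div_lt_one (by linarith)]
    linarith
  rw [← integral_poisson_kernel hb, ← intervalIntegral.integral_div]
  refine intervalIntegral.integral_congr fun θ _ ↦ ?_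
  have hD := (one_add_mul_cos_pos ha θ).ne'
  have hs1 : 1 + s ≠ 0 := by linarith
  have hnum : 1 - (a / (1 + s)) ^ 2 = 2 * s / (1 + s) := by
    field_simp
    linear_combination -hsq
  have hden : 1 + 2 * (a / (1 + s)) * cos θ + (a / (1 + s)) ^ 2
      = 2 * (1 + a * cos θ) / (1 + s) := by
    field_simp
    linear_combination hsq
  simp only [hnum, hden]
  field_simp

lemma integral_sin_sq_div_one_add_mul_cos {a : ℝ} (ha : |a| < 1) (ha0 : a ≠ 0) :
    ∫ θ in (-π)..π, sin θ ^ 2 / (1 + a * cos θ) = 2 * π * (1 - √(1 - a ^ 2)) / a ^ 2 := by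
  have hlt : 0 < 1 - a ^ 2 := by linarith [(sq_lt_one_iff_abs_lt_one a).mpr ha]
  have hs : √(1 - a ^ 2) ≠ 0 := (sqrt_pos.mpr hlt).ne'
  have hsplit (θ : ℝ) : sin θ ^ 2 / (1 + a * cos θ)
      = ((1 - a * cos θ) - (1 - a ^ 2) * (1 + a * cos θ)⁻¹) / a ^ 2 := by
    have hD := (one_add_mul_cos_pos ha θ).ne'
    field_simp
    linear_combination a ^ 2 * sin_sq_add_cos_sq θ
  have hint : IntervalIntegrable (fun θ ↦ (1 - a ^ 2) * (1 + a * cos θ)⁻¹) volume (-π) π :=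
    (continuous_const.mul (Continuous.inv₀ (by fun_prop)
      fun θ ↦ (one_add_mul_cos_pos ha θ).ne')).intervalIntegrable _ _
  simp_rw [hsplit]
  rw [intervalIntegral.integral_div, intervalIntegral.integral_sub
    (Continuous.intervalIntegrable (by fun_prop) _ _) hint, intervalIntegral.integral_const_mul,
    integral_inv_one_add_mul_cos ha, intervalIntegral.integral_sub
    (Continuous.intervalIntegrable (by fun_prop) _ _)
    (Continuous.intervalIntegrable (by fun_prop) _ _), intervalIntegral.integral_const_mul,
    integral_cos]
  simp only [intervalIntegral.integral_const, sin_neg, sin_pi, smul_eq_mul]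
  field_simp
  linear_combination 2 * π * sq_sqrt hlt.le

/-- For `0 < ρ < 1/2`, the Fisher information for location of the
cardioid density `f_C(θ) = (1+2ρcos θ)/(2π)`, with score
`φ_C(θ) = 2ρ sin θ/(1+2ρcos θ)`, satisfies
`Γ_{C;11} = ∫ φ_C² f_C = (2ρ²/π)∫ sin²θ/(1+2ρcos θ) dθ = 1 - √(1-4ρ²)`, and the
cross-information quantity `Γ_{C,1;12} = ∫ sin θ · φ_C · f_C = ρ`. -/
theorem cardioid_fisher_information_location
    (ρ : ℝ) (h0 : 0 < ρ) (h1 : ρ < 1 / 2) :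
    (∫ θ in (-π)..π,
        (2 * ρ * Real.sin θ / (1 + 2 * ρ * Real.cos θ)) ^ 2 *
          ((1 + 2 * ρ * Real.cos θ) / (2 * π))
      = 1 - Real.sqrt (1 - 4 * ρ ^ 2)) ∧
    ((2 * ρ ^ 2 / π) * ∫ θ in (-π)..π, (Real.sin θ) ^ 2 / (1 + 2 * ρ * Real.cos θ)
      = 1 - Real.sqrt (1 - 4 * ρ ^ 2)) ∧
    (∫ θ in (-π)..π,
        Real.sin θ * (2 * ρ * Real.sin θ / (1 + 2 * ρ * Real.cos θ)) *
          ((1 + 2 * ρ * Real.cos θ) / (2 * π))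
      = ρ) := by
  have ha : |2 * ρ| < 1 := by
    rw [abs_of_pos (by linarith)]
    linarith
  have hsin := integral_sin_sq_div_one_add_mul_cos ha (by positivity)
  rw [show 1 - (2 * ρ) ^ 2 = 1 - 4 * ρ ^ 2 by ring] at hsin
  have hinfo : 2 * ρ ^ 2 / π * ∫ θ in (-π)..π, sin θ ^ 2 / (1 + 2 * ρ * cos θ)
      = 1 - √(1 - 4 * ρ ^ 2) := by
    rw [hsin]
    field_simp
  refine ⟨?_, hinfo, ?_⟩
  · rw [← hinfo, ← intervalIntegral.integral_const_mul]
    refine intervalIntegral.integral_congr fun θ _ ↦ ?_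
    have hD := (one_add_mul_cos_pos ha θ).ne'
    field_simp
  · have hcross (θ : ℝ) : sin θ * (2 * ρ * sin θ / (1 + 2 * ρ * cos θ)) *
        ((1 + 2 * ρ * cos θ) / (2 * π)) = ρ / π * sin θ ^ 2 := by
      have hD := (one_add_mul_cos_pos ha θ).ne'
      field_simp
    simp_rw [hcross]
    rw [intervalIntegral.integral_const_mul, integral_sin_sq]
    simp
end
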